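/- Let m ≥ 1, let f : ℝ^m → ℝ be continuously differentiable with f and ∇f bounded and uniformly continuous, and let Q : ℝ × ℝ^m → ℝ be Lipschitz on bounded sets (for every r > 0 there is L with |Q(a,p) − Q(b,q)| ≤ L(|a − b| + ‖p − q‖) whenever |a|, |b|, ‖p‖, ‖q‖ ≤ r). Then there exist T > 0 and a function u : [0,T] × ℝ^m → ℝ such that: (i) u(0,·) = f; (ii) each u(t,·) is continuously differentiable with sup_{t∈[0,T], x} (|u(t,x)| + ‖∇_x u(t,x)‖) < ∞; (iii) t ↦ u(t,·) is continuous in the C¹ sup-norm, i.e. sup_x (|u(t,x) − u(t₀,x)| + ‖∇_x u(t,x) − ∇_x u(t₀,x)‖) → 0 as t → t₀, for every t₀ ∈ [0,T]; and (iv) for all t ∈ [0,T] and x ∈ ℝ^m, u(t,x) = (P_t f)(x) + ∫₀^t P_{t−s}( y ↦ Q(u(s,y), ∇_y u(s,y)) )(x) ds. That is, the semilinear heat equation ∂_t u − Δu = Q(u, ∇u), u(0) = f, whose nonlinearity involves one derivative of u, has a short-time mild solution. -/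

import Mathlib

open MeasureTheory Set

/-- The Euclidean heat kernel `H_t(x,y) = (4πt)^{-m/2} exp(-‖x-y‖²/(4t))` on `ℝ^m`. -/
noncomputable def heatKernel (m : ℕ) (t : ℝ) (x y : EuclideanSpace ℝ (Fin m)) : ℝ :=
  (4 * Real.pi * t) ^ (-(m : ℝ) / 2) * Real.exp (-‖x - y‖ ^ 2 / (4 * t))

/-- The Euclidean heat semigroup: `(P_t f)(x) = ∫ H_t(x,y) f(y) dy` for `t > 0`, and
`P_0 = id` (extended as the identity for `t ≤ 0`). -/
noncomputable def heatSemigroup (m : ℕ) (t : ℝ) (f : EuclideanSpace ℝ (Fin m) → ℝ)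
    (x : EuclideanSpace ℝ (Fin m)) : ℝ :=
  if t ≤ 0 then f x else ∫ y, heatKernel m t x y * f y

open Filter Topology

section UniformContinuity

/-- An integral depending on a parameter is uniformly continuous in that parameter if the integrand
is, for almost every value of the integration variable, and is dominated. -/
theorem uniformContinuous_integral_of_dominated {P Ω G : Type*} [PseudoMetricSpace P]
    [MeasurableSpace Ω] [NormedAddCommGroup G] [NormedSpace ℝ G] {μ : Measure Ω}
    {h : P → Ω → G} {bound : Ω → ℝ} (hm : ∀ p, AEStronglyMeasurable (h p) μ)
    (hb : ∀ p, ∀ᵐ ω ∂μ, ‖h p ω‖ ≤ bound ω) (hbi : Integrable bound μ)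
    (hu : ∀ᵐ ω ∂μ, UniformContinuous fun p => h p ω) :
    UniformContinuous fun p => ∫ ω, h p ω ∂μ := by
  have hi : ∀ p, Integrable (h p) μ := fun p => hbi.mono' (hm p) (hb p)
  have key : Tendsto (fun q : P × P => ∫ ω, ‖h q.1 ω - h q.2 ω‖ ∂μ) (uniformity P) (𝓝 0) := by
    rw [← integral_zero Ω ℝ (μ := μ)]
    refine tendsto_integral_filter_of_dominated_convergence (fun ω => 2 * bound ω)
      (.of_forall fun q => ((hm q.1).sub (hm q.2)).norm) (.of_forall fun q => ?_)
      (hbi.const_mul 2) ?_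
    · filter_upwards [hb q.1, hb q.2] with ω h1 h2
      rw [norm_norm]
      linarith [norm_sub_le (h q.1 ω) (h q.2 ω)]
    · filter_upwards [hu] with ω hω
      simpa only [dist_eq_norm] using tendsto_uniformity_iff_dist_tendsto_zero.1 hω
  refine tendsto_uniformity_iff_dist_tendsto_zero.2
    (squeeze_zero (fun _ => dist_nonneg) (fun q => ?_) key)
  rw [dist_eq_norm, ← integral_sub (hi _) (hi _)]
  exact norm_integral_le_integral_norm _

theorem UniformContinuous.smul_of_norm_le {P G : Type*} [PseudoMetricSpace P]
    [NormedAddCommGroup G] [NormedSpace ℝ G] {f : P → ℝ} {g : P → G} {C D : ℝ}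
    (hf : UniformContinuous f) (hg : UniformContinuous g)
    (hC : ∀ p, |f p| ≤ C) (hD : ∀ p, ‖g p‖ ≤ D) : UniformContinuous fun p => f p • g p := by
  have h1 := tendsto_uniformity_iff_dist_tendsto_zero.1 hf
  have h2 := tendsto_uniformity_iff_dist_tendsto_zero.1 hg
  have h3 : Tendsto (fun q : P × P => dist (f q.1) (f q.2) * D + C * dist (g q.1) (g q.2))
      (uniformity P) (𝓝 0) := by
    simpa using (h1.mul_const D).add (h2.const_mul C)
  refine tendsto_uniformity_iff_dist_tendsto_zero.2
    (squeeze_zero (fun _ => dist_nonneg) (fun q => ?_) h3)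
  have e : f q.1 • g q.1 - f q.2 • g q.2
      = (f q.1 - f q.2) • g q.1 + f q.2 • (g q.1 - g q.2) := by
    rw [sub_smul, smul_sub]; abel
  rw [dist_eq_norm, e, dist_eq_norm, dist_eq_norm]
  refine (norm_add_le _ _).trans ?_
  rw [norm_smul, norm_smul]
  gcongr
  · exact hD _
  · exact hC _

theorem Real.uniformContinuous_sqrt : UniformContinuous Real.sqrt := by
  have h : Tendsto (fun q : ℝ × ℝ => √(dist q.1 q.2)) (uniformity ℝ) (𝓝 0) := by
    have := tendsto_uniformity_iff_dist_tendsto_zero.1 (uniformContinuous_id (α := ℝ))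
    simpa [Function.comp_def] using (Real.continuous_sqrt.tendsto 0).comp this
  refine tendsto_uniformity_iff_dist_tendsto_zero.2
    (squeeze_zero (fun _ => dist_nonneg) (fun q => ?_) h)
  have aux : ∀ a b : ℝ, √a ≤ √b + √(dist a b) := fun a b => by
    refine Real.sqrt_le_iff.2 ⟨by positivity, ?_⟩
    have hb : b ≤ √b ^ 2 := by
      rcases le_total b 0 with hb | hb
      · exact hb.trans (sq_nonneg _)
      · exact (Real.sq_sqrt hb).ge
    have hd : √(dist a b) ^ 2 = dist a b := Real.sq_sqrt dist_nonneg
    have hab : a - b ≤ dist a b := le_abs_self (a - b)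
    nlinarith [Real.sqrt_nonneg b, Real.sqrt_nonneg (dist a b),
      mul_nonneg (Real.sqrt_nonneg b) (Real.sqrt_nonneg (dist a b))]
  rw [Real.dist_eq, abs_le]
  constructor
  · have := aux q.2 q.1
    rw [dist_comm q.2] at this
    linarith
  · linarith [aux q.1 q.2]

end UniformContinuity

section Gradient

theorem hasGradientAt_integral_of_dominated {Ω E : Type*} [MeasurableSpace Ω]
    [NormedAddCommGroup E] [InnerProductSpace ℝ E] [CompleteSpace E] {μ : Measure Ω}
    {F : E → Ω → ℝ} {G : E → Ω → E} {bound : Ω → ℝ} {x₀ : E} {s : Set E} (hs : s ∈ 𝓝 x₀)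
    (hF : ∀ x, AEStronglyMeasurable (F x) μ) (hFi : Integrable (F x₀) μ)
    (hG : AEStronglyMeasurable (G x₀) μ) (hb : ∀ᵐ ω ∂μ, ∀ x ∈ s, ‖G x ω‖ ≤ bound ω)
    (hbi : Integrable bound μ)
    (hd : ∀ᵐ ω ∂μ, ∀ x ∈ s, HasGradientAt (fun x => F x ω) (G x ω) x) :
    HasGradientAt (fun x => ∫ ω, F x ω ∂μ) (∫ ω, G x₀ ω ∂μ) x₀ := by
  have hGi : Integrable (G x₀) μ :=
    hbi.mono' hG (hb.mono fun ω h => h x₀ (mem_of_mem_nhds hs))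
  have hc : Continuous fun v : E => InnerProductSpace.toDual ℝ E v :=
    (InnerProductSpace.toDual ℝ E).continuous
  have key := hasFDerivAt_integral_of_dominated_of_fderiv_le (𝕜 := ℝ) (μ := μ) (F := F)
    (F' := fun x ω => InnerProductSpace.toDual ℝ E (G x ω)) (bound := bound) hs
    (.of_forall hF) hFi (hc.comp_aestronglyMeasurable hG)
    (hb.mono fun ω h x hx => by simpa using h x hx) hbi
    (hd.mono fun ω h x hx => (h x hx).hasFDerivAt)
  rw [hasGradientAt_iff_hasFDerivAt]
  refine key.congr_fderiv (ContinuousLinearMap.ext fun v => ?_)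
  have hGd : Integrable (fun ω => InnerProductSpace.toDual ℝ E (G x₀ ω)) μ :=
    hbi.mono' (hc.comp_aestronglyMeasurable hG)
      (hb.mono fun ω h => by simpa using h x₀ (mem_of_mem_nhds hs))
  rw [ContinuousLinearMap.integral_apply hGd]
  simp only [InnerProductSpace.toDual_apply_apply]
  rw [real_inner_comm, ← integral_inner hGi v]
  exact integral_congr_ae (.of_forall fun ω => (real_inner_comm _ _))

end Gradient

section HeatMeasure

/-- The Gaussian measure with density `H_1(·, 0)`; the heat semigroup averages translates by
`√t z` with `z` distributed according to this measure. -/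
noncomputable def heatMeasure (m : ℕ) : Measure (EuclideanSpace ℝ (Fin m)) :=
  volume.withDensity fun z => ENNReal.ofReal (heatKernel m 1 z 0)

theorem heatKernel_pos (m : ℕ) {t : ℝ} (ht : 0 < t) (x y : EuclideanSpace ℝ (Fin m)) :
    0 < heatKernel m t x y := by
  unfold heatKernel; positivity

theorem continuous_heatKernel_left (m : ℕ) (t : ℝ) (y : EuclideanSpace ℝ (Fin m)) :
    Continuous fun x => heatKernel m t x y := by
  unfold heatKernel; fun_prop

theorem continuous_heatKernel_right (m : ℕ) (t : ℝ) (x : EuclideanSpace ℝ (Fin m)) :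
    Continuous (heatKernel m t x) := by
  unfold heatKernel; fun_prop

theorem measurable_heatKernel_one (m : ℕ) :
    Measurable fun z : EuclideanSpace ℝ (Fin m) => ENNReal.ofReal (heatKernel m 1 z 0) :=
  (continuous_heatKernel_left m 1 0).measurable.ennreal_ofReal

theorem integral_heatMeasure {m : ℕ} {G : Type*} [NormedAddCommGroup G] [NormedSpace ℝ G]
    (H : EuclideanSpace ℝ (Fin m) → G) :
    ∫ z, H z ∂heatMeasure m = ∫ z, heatKernel m 1 z 0 • H z := by
  rw [heatMeasure, integral_withDensity_eq_integral_toReal_smul (measurable_heatKernel_one m)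
    (.of_forall fun _ => ENNReal.ofReal_lt_top)]
  simp only [ENNReal.toReal_ofReal (heatKernel_pos m one_pos _ _).le]

theorem integrable_exp_neg_mul_norm_sq (m : ℕ) {b : ℝ} (hb : 0 < b) :
    Integrable fun z : EuclideanSpace ℝ (Fin m) => Real.exp (-b * ‖z‖ ^ 2) := by
  refine .of_integral_ne_zero ?_
  rw [GaussianFourier.integral_rexp_neg_mul_sq_norm hb]
  positivity

theorem integral_heatKernel_one (m : ℕ) :
    ∫ z : EuclideanSpace ℝ (Fin m), heatKernel m 1 z 0 = 1 := by
  have h := GaussianFourier.integral_rexp_neg_mul_sq_norm (V := EuclideanSpace ℝ (Fin m))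
    (b := 1 / 4) (by norm_num)
  have e : ∀ z : EuclideanSpace ℝ (Fin m), heatKernel m 1 z 0
      = (4 * Real.pi) ^ (-(m : ℝ) / 2) * Real.exp (-(1 / 4) * ‖z‖ ^ 2) := fun z => by
    unfold heatKernel
    rw [sub_zero, mul_one]
    congr 2
    ring
  simp only [e]
  rw [integral_const_mul, h, finrank_euclideanSpace_fin, neg_div, Real.rpow_neg (by positivity),
    show Real.pi / (1 / 4) = 4 * Real.pi by ring]
  exact inv_mul_cancel₀ (by positivity)

instance (m : ℕ) : IsProbabilityMeasure (heatMeasure m) := by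
  refine ⟨?_⟩
  have hi : Integrable fun z : EuclideanSpace ℝ (Fin m) => heatKernel m 1 z 0 :=
    .of_integral_ne_zero (by rw [integral_heatKernel_one]; exact one_ne_zero)
  rw [heatMeasure, withDensity_apply _ MeasurableSet.univ, Measure.restrict_univ,
    ← ofReal_integral_eq_lintegral_ofReal hi (.of_forall fun z => (heatKernel_pos m one_pos _ _).le),
    integral_heatKernel_one, ENNReal.ofReal_one]

theorem le_const_mul_exp {a : ℝ} (ha : 0 < a) (r : ℝ) :
    r ≤ (1 + 1 / a) * Real.exp (a * r ^ 2) := by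
  have h1 : r ≤ 1 + r ^ 2 := by nlinarith [sq_nonneg (r - 1)]
  have h2 : 1 + r ^ 2 ≤ (1 + 1 / a) * (a * r ^ 2 + 1) := by
    have : (1 + 1 / a) * (a * r ^ 2 + 1) = 1 + r ^ 2 + (a * r ^ 2 + 1 / a) := by
      field_simp; ring
    rw [this]
    have : 0 ≤ a * r ^ 2 + 1 / a := by positivity
    linarith
  exact h1.trans (h2.trans (by gcongr; exact Real.add_one_le_exp _))

/-- Gaussian domination of the gradient of the heat kernel, locally uniform in the base point. -/
theorem norm_mul_heatKernel_le {m : ℕ} {t : ℝ} (ht : 0 < t) {x x₀ : EuclideanSpace ℝ (Fin m)}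
    (hx : ‖x - x₀‖ ≤ 1) (y : EuclideanSpace ℝ (Fin m)) :
    ‖x - y‖ * heatKernel m t x y ≤ (4 * Real.pi * t) ^ (-(m : ℝ) / 2) * (1 + 8 * t) *
      Real.exp (1 / (8 * t)) * Real.exp (-(1 / (16 * t)) * ‖y - x₀‖ ^ 2) := by
  have h1 := le_const_mul_exp (a := 1 / (8 * t)) (by positivity) ‖x - y‖
  have h2 : ‖y - x₀‖ ^ 2 ≤ 2 * ‖x - y‖ ^ 2 + 2 := by
    have h3 : ‖y - x₀‖ ≤ ‖x - y‖ + ‖x - x₀‖ := by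
      rw [show y - x₀ = -(x - y) + (x - x₀) by abel, ← norm_neg (x - y)]
      exact norm_add_le _ _
    have h4 : ‖y - x₀‖ ≤ ‖x - y‖ + 1 := by linarith
    nlinarith [norm_nonneg (y - x₀), norm_nonneg (x - y), sq_nonneg (‖x - y‖ - 1)]
  have h5 : Real.exp (1 / (8 * t) * ‖x - y‖ ^ 2) * Real.exp (-‖x - y‖ ^ 2 / (4 * t))
      ≤ Real.exp (1 / (8 * t)) * Real.exp (-(1 / (16 * t)) * ‖y - x₀‖ ^ 2) := by
    rw [← Real.exp_add, ← Real.exp_add]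
    refine Real.exp_le_exp.2 ?_
    have : (1 / (8 * t) + -(1 / (16 * t)) * ‖y - x₀‖ ^ 2)
        - (1 / (8 * t) * ‖x - y‖ ^ 2 + -‖x - y‖ ^ 2 / (4 * t))
        = 1 / (16 * t) * (2 * ‖x - y‖ ^ 2 + 2 - ‖y - x₀‖ ^ 2) := by
      field_simp; ring
    have h6 : 0 ≤ 1 / (16 * t) * (2 * ‖x - y‖ ^ 2 + 2 - ‖y - x₀‖ ^ 2) :=
      mul_nonneg (by positivity) (by linarith)
    linarith
  unfold heatKernel
  have hc : 0 ≤ (4 * Real.pi * t) ^ (-(m : ℝ) / 2) := by positivity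
  calc ‖x - y‖ * ((4 * Real.pi * t) ^ (-(m : ℝ) / 2) * Real.exp (-‖x - y‖ ^ 2 / (4 * t)))
      ≤ ((1 + 1 / (1 / (8 * t))) * Real.exp (1 / (8 * t) * ‖x - y‖ ^ 2)) *
        ((4 * Real.pi * t) ^ (-(m : ℝ) / 2) * Real.exp (-‖x - y‖ ^ 2 / (4 * t))) := by gcongr
    _ = (4 * Real.pi * t) ^ (-(m : ℝ) / 2) * (1 + 8 * t) *
        (Real.exp (1 / (8 * t) * ‖x - y‖ ^ 2) * Real.exp (-‖x - y‖ ^ 2 / (4 * t))) := by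
      rw [one_div_one_div]; ring
    _ ≤ _ := by rw [mul_assoc _ (Real.exp (1 / (8 * t)))]; gcongr

theorem integrable_norm_heatMeasure (m : ℕ) :
    Integrable (fun z : EuclideanSpace ℝ (Fin m) => ‖z‖) (heatMeasure m) := by
  rw [heatMeasure, integrable_withDensity_iff (measurable_heatKernel_one m)
    (.of_forall fun _ => ENNReal.ofReal_lt_top)]
  simp only [ENNReal.toReal_ofReal (heatKernel_pos m one_pos _ _).le]
  refine ((integrable_exp_neg_mul_norm_sq m (b := 1 / 16) (by norm_num)).const_mul
    ((4 * Real.pi * 1) ^ (-(m : ℝ) / 2) * (1 + 8 * 1) * Real.exp (1 / (8 * 1)))).mono' ?_ ?_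
  · exact (continuous_norm.mul (continuous_heatKernel_left m 1 0)).aestronglyMeasurable
  · refine .of_forall fun z => ?_
    have h := norm_mul_heatKernel_le one_pos (x := 0) (x₀ := 0) (by simp) z
    have hs : heatKernel m 1 0 z = heatKernel m 1 z 0 := by
      unfold heatKernel; rw [norm_sub_rev]
    rw [hs, zero_sub, norm_neg, sub_zero] at h
    rw [Real.norm_of_nonneg (mul_nonneg (norm_nonneg _) (heatKernel_pos m one_pos _ _).le)]
    simpa only [mul_one] using h

theorem integral_heatKernel_smul {m : ℕ} {G : Type*} [NormedAddCommGroup G] [NormedSpace ℝ G]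
    {t : ℝ} (ht : 0 < t) (H : EuclideanSpace ℝ (Fin m) → G) (x : EuclideanSpace ℝ (Fin m)) :
    ∫ y, heatKernel m t x y • H y = ∫ z, H (x - √t • z) ∂heatMeasure m := by
  have hs : 0 < √t := Real.sqrt_pos.2 ht
  have hk : ∀ z : EuclideanSpace ℝ (Fin m),
      heatKernel m 1 z 0 = √t ^ m * heatKernel m t x (x - √t • z) := fun z => by
    unfold heatKernel
    have e1 : (4 * Real.pi * t) ^ (-(m : ℝ) / 2)
        = (4 * Real.pi * 1) ^ (-(m : ℝ) / 2) * (√t ^ m)⁻¹ := by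
      rw [mul_one, Real.mul_rpow (by positivity) ht.le, Real.sqrt_eq_rpow, ← Real.rpow_natCast,
        ← Real.rpow_mul ht.le, ← Real.rpow_neg ht.le]
      congr 2; ring
    have e2 : -‖x - (x - √t • z)‖ ^ 2 / (4 * t) = -‖z - 0‖ ^ 2 / (4 * 1) := by
      rw [sub_sub_cancel, norm_smul, Real.norm_of_nonneg hs.le, mul_pow, Real.sq_sqrt ht.le,
        sub_zero]
      field_simp
    rw [e1, e2]
    field_simp
  rw [integral_heatMeasure, ← integral_sub_left_eq_self (fun y => heatKernel m t x y • H y) _ x]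
  simp only [hk, mul_smul]
  rw [integral_smul, Measure.integral_comp_smul volume
    (fun w => heatKernel m t x (x - w) • H (x - w)) (√t), finrank_euclideanSpace_fin,
    abs_of_pos (by positivity), smul_smul, mul_inv_cancel₀ (by positivity), one_smul]

theorem integral_heatKernel {m : ℕ} {t : ℝ} (ht : 0 < t) (x : EuclideanSpace ℝ (Fin m)) :
    ∫ y, heatKernel m t x y = 1 := by
  have h := integral_heatKernel_smul ht (fun _ : EuclideanSpace ℝ (Fin m) => (1 : ℝ)) x
  rw [integral_const, probReal_univ, one_smul] at h
  simpa only [smul_eq_mul, mul_one] using h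

theorem integrable_heatKernel {m : ℕ} {t : ℝ} (ht : 0 < t) (x : EuclideanSpace ℝ (Fin m)) :
    Integrable (heatKernel m t x) := by
  apply Integrable.of_integral_ne_zero
  rw [integral_heatKernel ht x]
  exact one_ne_zero

theorem heatSemigroup_eq_integral_heatMeasure {m : ℕ} (t : ℝ) (h : EuclideanSpace ℝ (Fin m) → ℝ)
    (x : EuclideanSpace ℝ (Fin m)) :
    heatSemigroup m t h x = ∫ z, h (x - √t • z) ∂heatMeasure m := by
  unfold heatSemigroup
  split_ifs with ht
  · simp [Real.sqrt_eq_zero_of_nonpos ht]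
  · exact integral_heatKernel_smul (not_le.1 ht) h x

theorem hasGradientAt_heatKernel {m : ℕ} (t : ℝ) (x y : EuclideanSpace ℝ (Fin m)) :
    HasGradientAt (fun x => heatKernel m t x y)
      (-(1 / (2 * t)) • heatKernel m t x y • (x - y)) x := by
  rw [hasGradientAt_iff_hasFDerivAt]
  have h1 : HasFDerivAt (fun x : EuclideanSpace ℝ (Fin m) => x - y)
      (ContinuousLinearMap.id ℝ _) x := (hasFDerivAt_id x).sub_const y
  have h2 := ((h1.norm_sq.neg.mul_const (1 / (4 * t))).exp.const_mul
    ((4 * Real.pi * t) ^ (-(m : ℝ) / 2)))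
  have e : (fun x => heatKernel m t x y) = fun x => (4 * Real.pi * t) ^ (-(m : ℝ) / 2) *
      Real.exp (-‖x - y‖ ^ 2 * (1 / (4 * t))) := by
    ext x; rw [heatKernel, mul_one_div]
  rw [e]
  refine h2.congr_fderiv (ContinuousLinearMap.ext fun v => ?_)
  simp [heatKernel, div_eq_mul_inv]
  ring

/-- For `t > 0` the heat semigroup maps bounded continuous functions to differentiable ones. -/
theorem hasGradientAt_integral_heatMeasure {m : ℕ} {t : ℝ} (ht : 0 < t)
    {h : EuclideanSpace ℝ (Fin m) → ℝ} {M : ℝ} (hc : Continuous h) (hM : ∀ x, |h x| ≤ M)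
    (x₀ : EuclideanSpace ℝ (Fin m)) :
    HasGradientAt (fun x => ∫ z, h (x - √t • z) ∂heatMeasure m)
      (-(1 / (2 * √t)) • ∫ z, h (x₀ - √t • z) • z ∂heatMeasure m) x₀ := by
  have hM0 : 0 ≤ M := (abs_nonneg _).trans (hM 0)
  have hk : ∀ x, Continuous (heatKernel m t x) := continuous_heatKernel_right m t
  have hki : Integrable (heatKernel m t x₀) := integrable_heatKernel ht x₀
  have hs : 0 < √t := Real.sqrt_pos.2 ht
  have key := hasGradientAt_integral_of_dominated (μ := volume)
    (F := fun x y => heatKernel m t x y • h y)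
    (G := fun x y => heatKernel m t x y • (-(1 / (2 * t)) * h y) • (x - y))
    (bound := fun y => (1 / (2 * t) * M) * ((4 * Real.pi * t) ^ (-(m : ℝ) / 2) * (1 + 8 * t) *
      Real.exp (1 / (8 * t)) * Real.exp (-(1 / (16 * t)) * ‖y - x₀‖ ^ 2)))
    (Metric.closedBall_mem_nhds x₀ one_pos)
    (fun x => ((hk x).smul hc).aestronglyMeasurable) ?_ ?_ ?_ ?_ ?_
  · simp only [integral_heatKernel_smul ht] at key
    convert key using 1
    rw [← integral_smul]
    congr 1
    ext1 z
    rw [sub_sub_cancel, smul_smul, smul_smul]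
    congr 1
    have : t = √t * √t := (Real.mul_self_sqrt ht.le).symm
    nth_rw 3 [this]
    field_simp
  · refine (hki.mul_const M).mono' ((hk x₀).smul hc).aestronglyMeasurable (.of_forall fun y => ?_)
    rw [norm_smul, Real.norm_of_nonneg (heatKernel_pos m ht _ _).le, Real.norm_eq_abs]
    exact mul_le_mul_of_nonneg_left (hM y) (heatKernel_pos m ht _ _).le
  · exact ((hk x₀).smul ((continuous_const.mul hc).smul
      (continuous_const.sub continuous_id))).aestronglyMeasurable
  · refine .of_forall fun y x hx => ?_
    have h1 := norm_mul_heatKernel_le ht (x₀ := x₀) (by simpa [dist_eq_norm] using hx) y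
    rw [norm_smul, norm_smul, Real.norm_of_nonneg (heatKernel_pos m ht _ _).le, norm_mul, norm_neg,
      Real.norm_of_nonneg (by positivity : 0 ≤ 1 / (2 * t)), Real.norm_eq_abs]
    calc heatKernel m t x y * (1 / (2 * t) * |h y| * ‖x - y‖)
        = (1 / (2 * t) * |h y|) * (‖x - y‖ * heatKernel m t x y) := by ring
      _ ≤ _ := by
        have := heatKernel_pos m ht x y
        gcongr
        exact hM y
  · exact (((integrable_exp_neg_mul_norm_sq m (b := 1 / (16 * t)) (by positivity)).comp_sub_right
      x₀).const_mul _).const_mul _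
  · refine .of_forall fun y x _ => ?_
    have h1 := hasGradientAt_heatKernel t x y
    rw [hasGradientAt_iff_hasFDerivAt] at h1 ⊢
    refine (h1.mul_const (h y)).congr_fderiv (ContinuousLinearMap.ext fun v => ?_)
    simp
    ring

end HeatMeasure

section HeatAverage

variable {m : ℕ}

local notation "𝔼" => EuclideanSpace ℝ (Fin m)

theorem uniformContinuous_sub_sqrt_smul (z : 𝔼) :
    UniformContinuous fun p : ℝ × 𝔼 => p.2 - √p.1 • z :=
  uniformContinuous_snd.sub ((ContinuousLinearMap.toSpanSingleton ℝ z).uniformContinuous.comp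
    (Real.uniformContinuous_sqrt.comp uniformContinuous_fst))

theorem uniformContinuous_heatAverage {G : Type*} [NormedAddCommGroup G] [NormedSpace ℝ G]
    {h : 𝔼 → G} {M : ℝ} (hu : UniformContinuous h) (hM : ∀ x, ‖h x‖ ≤ M) :
    UniformContinuous fun p : ℝ × 𝔼 => ∫ z, h (p.2 - √p.1 • z) ∂heatMeasure m :=
  uniformContinuous_integral_of_dominated (bound := fun _ => M)
    (fun p => (hu.continuous.comp (by fun_prop)).aestronglyMeasurable)
    (fun p => .of_forall fun z => hM _) (integrable_const M)
    (.of_forall fun z => hu.comp (uniformContinuous_sub_sqrt_smul z))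

theorem norm_heatAverage_le {G : Type*} [NormedAddCommGroup G] [NormedSpace ℝ G]
    {h : 𝔼 → G} {M : ℝ} (hM : ∀ x, ‖h x‖ ≤ M) (t : ℝ) (x : 𝔼) :
    ‖∫ z, h (x - √t • z) ∂heatMeasure m‖ ≤ M := by
  simpa using norm_integral_le_of_norm_le_const (μ := heatMeasure m)
    (.of_forall fun z => hM (x - √t • z))

theorem hasGradientAt_heatAverage {f : 𝔼 → ℝ} {M : ℝ} (hf : ContDiff ℝ 1 f)
    (hM : ∀ x, |f x| ≤ M) (hG : ∀ x, ‖gradient f x‖ ≤ M) (hc : Continuous (gradient f))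
    (t : ℝ) (x : 𝔼) :
    HasGradientAt (fun x => ∫ z, f (x - √t • z) ∂heatMeasure m)
      (∫ z, gradient f (x - √t • z) ∂heatMeasure m) x := by
  have hf0 := hf.continuous
  have hfm : ∀ x, AEStronglyMeasurable (fun z => f (x - √t • z)) (heatMeasure m) := fun x =>
    (by fun_prop : Continuous fun z : 𝔼 => f (x - √t • z)).aestronglyMeasurable
  have hgm : AEStronglyMeasurable (fun z => gradient f (x - √t • z)) (heatMeasure m) :=
    (by fun_prop : Continuous fun z : 𝔼 => gradient f (x - √t • z)).aestronglyMeasurable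
  refine hasGradientAt_integral_of_dominated (F := fun x z => f (x - √t • z))
    (G := fun x z => gradient f (x - √t • z)) (bound := fun _ => M) univ_mem hfm
    ((integrable_const M).mono' (hfm x) (.of_forall fun z => hM _))
    hgm (.of_forall fun z y _ => hG (y - √t • z))
    (integrable_const M) (.of_forall fun z y _ => ?_)
  have h1 := ((hf.differentiable one_ne_zero) (y - √t • z)).hasGradientAt
  rw [hasGradientAt_iff_hasFDerivAt] at h1 ⊢
  exact (hasFDerivAt_comp_sub (√t • z)).2 h1

variable {q : ℝ × EuclideanSpace ℝ (Fin m) → ℝ} {M : ℝ}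

theorem uniformContinuous_heatAverage_path (hu : UniformContinuous q) (hM : ∀ p, |q p| ≤ M) :
    UniformContinuous fun p : ℝ × ℝ × 𝔼 => ∫ z, q (p.1, p.2.2 - √p.2.1 • z) ∂heatMeasure m :=
  uniformContinuous_integral_of_dominated (bound := fun _ => M)
    (fun p => (hu.continuous.comp (by fun_prop)).aestronglyMeasurable)
    (fun p => .of_forall fun z => hM _) (integrable_const M)
    (.of_forall fun z => hu.comp (uniformContinuous_fst.prodMk
      ((uniformContinuous_sub_sqrt_smul z).comp uniformContinuous_snd)))

theorem uniformContinuous_heatAverage_smul_path (hu : UniformContinuous q)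
    (hM : ∀ p, |q p| ≤ M) :
    UniformContinuous fun p : ℝ × ℝ × 𝔼 =>
      ∫ z, q (p.1, p.2.2 - √p.2.1 • z) • z ∂heatMeasure m :=
  uniformContinuous_integral_of_dominated (bound := fun z => M * ‖z‖)
    (fun p => ((hu.continuous.comp (by fun_prop)).smul continuous_id).aestronglyMeasurable)
    (fun p => .of_forall fun z => by
      rw [norm_smul]; exact mul_le_mul_of_nonneg_right (hM _) (norm_nonneg _))
    ((integrable_norm_heatMeasure m).const_mul M)
    (.of_forall fun z => (ContinuousLinearMap.toSpanSingleton ℝ z).uniformContinuous.comp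
      (hu.comp (uniformContinuous_fst.prodMk
        ((uniformContinuous_sub_sqrt_smul z).comp uniformContinuous_snd))))

theorem norm_heatAverage_smul_path_le (hM : ∀ p, |q p| ≤ M) (p : ℝ × ℝ × 𝔼) :
    ‖∫ z, q (p.1, p.2.2 - √p.2.1 • z) • z ∂heatMeasure m‖ ≤ M * ∫ z, ‖z‖ ∂heatMeasure m := by
  rw [← integral_const_mul]
  refine norm_integral_le_of_norm_le ((integrable_norm_heatMeasure m).const_mul M)
    (.of_forall fun z => ?_)
  rw [norm_smul]
  exact mul_le_mul_of_nonneg_right (hM _) (norm_nonneg _)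

end HeatAverage

section TimeAverage

variable {X G : Type*} [NormedAddCommGroup G] [NormedSpace ℝ G]
  {a : ℝ × ℝ × X → G} {D : ℝ} {w : ℝ → ℝ}

theorem integrableOn_timeAverage [TopologicalSpace X] (ha : Continuous a) (hD : ∀ p, ‖a p‖ ≤ D)
    (hw : IntegrableOn w (Ioo 0 1)) (k t : ℝ) (x : X) :
    IntegrableOn (fun σ => (k * w σ) • a (t * σ, t * (1 - σ), x)) (Ioo 0 1) := by
  refine ((hw.const_mul k).norm.mul_const D).mono' ((hw.const_mul k).aestronglyMeasurable.smul
    (ha.comp (by fun_prop)).aestronglyMeasurable) (.of_forall fun σ => ?_)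
  rw [norm_smul]
  exact mul_le_mul_of_nonneg_left (hD _) (norm_nonneg _)

theorem norm_timeAverage_le (hD : ∀ p, ‖a p‖ ≤ D) (hw : IntegrableOn w (Ioo 0 1))
    (hw0 : ∀ σ, 0 ≤ w σ) (k t : ℝ) (x : X) :
    ‖∫ σ in Ioo 0 1, (k * w σ) • a (t * σ, t * (1 - σ), x)‖
      ≤ |k| * (∫ σ in Ioo 0 1, w σ) * D := by
  rw [← integral_const_mul, ← integral_mul_const]
  refine norm_integral_le_of_norm_le ((hw.const_mul _).mul_const D) (.of_forall fun σ => ?_)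
  rw [norm_smul, Real.norm_eq_abs, abs_mul, abs_of_nonneg (hw0 σ)]
  exact mul_le_mul_of_nonneg_left (hD _) (mul_nonneg (abs_nonneg _) (hw0 σ))

theorem uniformContinuous_timeAverage [PseudoMetricSpace X] (ha : UniformContinuous a) (hD : ∀ p, ‖a p‖ ≤ D)
    (hw : IntegrableOn w (Ioo 0 1)) {k c : ℝ → ℝ} {C : ℝ} (hk : UniformContinuous k)
    (hC : ∀ t, |k t| ≤ C) (hc : UniformContinuous c) :
    UniformContinuous fun p : ℝ × X =>
      ∫ σ in Ioo 0 1, (k p.1 * w σ) • a (c p.1 * σ, c p.1 * (1 - σ), p.2) := by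
  refine uniformContinuous_integral_of_dominated (bound := fun σ => C * ‖w σ‖ * D)
    (fun p => (integrableOn_timeAverage ha.continuous hD hw _ _ _).aestronglyMeasurable)
    (fun p => .of_forall fun σ => ?_) ((hw.norm.const_mul C).mul_const D)
    (.of_forall fun σ => ?_)
  · rw [norm_smul, norm_mul]
    have := hD (c p.1 * σ, c p.1 * (1 - σ), p.2)
    have h2 := (norm_nonneg _).trans this
    have := hC p.1
    rw [← Real.norm_eq_abs] at this
    have h3 := (norm_nonneg _).trans this
    gcongr
  · have h1 : ∀ r : ℝ, UniformContinuous fun p : ℝ × X => c p.1 * r := fun r =>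
      (hc.comp uniformContinuous_fst).mul_const' r
    refine UniformContinuous.smul_of_norm_le (C := C * |w σ|)
      ((hk.comp uniformContinuous_fst).mul_const' (w σ))
      (ha.comp ((h1 _).prodMk ((h1 _).prodMk uniformContinuous_snd))) (fun p => ?_)
      (fun p => hD _)
    rw [abs_mul]
    exact mul_le_mul_of_nonneg_right (hC _) (abs_nonneg _)

end TimeAverage

section Duhamel

variable {m : ℕ}

local notation "𝔼" => EuclideanSpace ℝ (Fin m)

/-- The Duhamel term `∫₀ᵗ P_{t-s} q(s) ds`, with `s = tσ`. -/
noncomputable def duhamel (q : ℝ × EuclideanSpace ℝ (Fin m) → ℝ) (t : ℝ)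
    (x : EuclideanSpace ℝ (Fin m)) : ℝ :=
  ∫ σ in Ioo (0 : ℝ) 1, (t * 1) • ∫ z, q (t * σ, x - √(t * (1 - σ)) • z) ∂heatMeasure m

/-- The gradient of the Duhamel term. -/
noncomputable def duhamelGradient (q : ℝ × EuclideanSpace ℝ (Fin m) → ℝ) (t : ℝ)
    (x : EuclideanSpace ℝ (Fin m)) : EuclideanSpace ℝ (Fin m) :=
  ∫ σ in Ioo (0 : ℝ) 1, (-(√t / 2) * (√(1 - σ))⁻¹) •
    ∫ z, q (t * σ, x - √(t * (1 - σ)) • z) • z ∂heatMeasure m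

/-- The constant `C` in the gradient estimate `‖∇ ∫₀ᵗ P_{t-s} q(s) ds‖ ≤ C √t ‖q‖`. -/
noncomputable def duhamelConst (m : ℕ) : ℝ :=
  1 / 2 * (∫ σ in Ioo (0 : ℝ) 1, (√(1 - σ))⁻¹) * ∫ z, ‖z‖ ∂heatMeasure m

theorem duhamelConst_nonneg (m : ℕ) : 0 ≤ duhamelConst m := by
  unfold duhamelConst
  have h1 : 0 ≤ ∫ σ in Ioo (0 : ℝ) 1, (√(1 - σ))⁻¹ := integral_nonneg fun σ => by positivity
  have h2 : 0 ≤ ∫ z, ‖z‖ ∂heatMeasure m := integral_nonneg fun z => norm_nonneg _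
  positivity

theorem integrableOn_inv_sqrt_one_sub : IntegrableOn (fun σ : ℝ => (√(1 - σ))⁻¹) (Ioo 0 1) := by
  have h := (intervalIntegral.intervalIntegrable_rpow' (a := 0) (b := 1) (r := -(1 / 2))
    (by norm_num)).comp_sub_left 1
  rw [sub_self, sub_zero] at h
  have h2 := ((intervalIntegrable_iff_integrableOn_Ioo_of_le zero_le_one).1 h.symm)
  refine h2.congr_fun (fun σ hσ => ?_) measurableSet_Ioo
  simp only [Real.sqrt_eq_rpow]
  rw [Real.rpow_neg (by linarith [hσ.2])]

theorem integrableOn_one_Ioo : IntegrableOn (fun _ : ℝ => (1 : ℝ)) (Ioo 0 1) :=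
  integrableOn_const (by simp)

variable {q r : ℝ × EuclideanSpace ℝ (Fin m) → ℝ} {M N : ℝ}

theorem abs_duhamel_le (hM : ∀ p, |q p| ≤ M) {t : ℝ} (ht : 0 ≤ t) (x : 𝔼) :
    |duhamel q t x| ≤ t * M := by
  have h := norm_timeAverage_le (w := fun _ => 1) (D := M)
    (a := fun p : ℝ × ℝ × 𝔼 => ∫ z, q (p.1, p.2.2 - √p.2.1 • z) ∂heatMeasure m)
    (fun p => norm_heatAverage_le (h := fun y => q (p.1, y)) (fun _ => hM _) p.2.1 p.2.2)
    integrableOn_one_Ioo (fun _ => zero_le_one) t t x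
  simpa [duhamel, abs_of_nonneg ht] using h

theorem norm_duhamelGradient_le (hM : ∀ p, |q p| ≤ M) (t : ℝ) (x : 𝔼) :
    ‖duhamelGradient q t x‖ ≤ √t * (duhamelConst m * M) := by
  have h := norm_timeAverage_le (w := fun σ => (√(1 - σ))⁻¹)
    (a := fun p : ℝ × ℝ × 𝔼 => ∫ z, q (p.1, p.2.2 - √p.2.1 • z) • z ∂heatMeasure m)
    (norm_heatAverage_smul_path_le hM)
    integrableOn_inv_sqrt_one_sub (fun σ => by positivity) (-(√t / 2)) t x
  refine h.trans_eq ?_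
  rw [abs_neg, abs_of_nonneg (by positivity), duhamelConst]
  ring

theorem uniformContinuous_duhamel (hu : UniformContinuous q) (hM : ∀ p, |q p| ≤ M)
    {c : ℝ → ℝ} {C : ℝ} (hc : UniformContinuous c) (hC : ∀ t, |c t| ≤ C) :
    UniformContinuous fun p : ℝ × 𝔼 => duhamel q (c p.1) p.2 :=
  uniformContinuous_timeAverage (w := fun _ => 1) (uniformContinuous_heatAverage_path hu hM)
    (fun p => norm_heatAverage_le (h := fun y => q (p.1, y)) (fun _ => hM _) p.2.1 p.2.2)
    integrableOn_one_Ioo hc hC hc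

theorem uniformContinuous_duhamelGradient (hu : UniformContinuous q) (hM : ∀ p, |q p| ≤ M)
    {c : ℝ → ℝ} {C : ℝ} (hc : UniformContinuous c) (hC : ∀ t, |c t| ≤ C) :
    UniformContinuous fun p : ℝ × 𝔼 => duhamelGradient q (c p.1) p.2 := by
  refine uniformContinuous_timeAverage (w := fun σ => (√(1 - σ))⁻¹) (k := fun t => -(√(c t) / 2))
    (C := √C / 2)
    (uniformContinuous_heatAverage_smul_path hu hM) (norm_heatAverage_smul_path_le hM)
    integrableOn_inv_sqrt_one_sub ?_ (fun t => ?_) hc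
  · exact ((Real.uniformContinuous_sqrt.comp hc).div_const' 2).neg
  · rw [abs_neg, abs_of_nonneg (by positivity)]
    have := Real.sqrt_le_sqrt ((le_abs_self _).trans (hC t))
    linarith

theorem duhamel_sub (hq : UniformContinuous q) (hM : ∀ p, |q p| ≤ M) (hr : UniformContinuous r)
    (hN : ∀ p, |r p| ≤ N) (t : ℝ) (x : 𝔼) :
    duhamel q t x - duhamel r t x = duhamel (fun p => q p - r p) t x := by
  have hi : ∀ {q : ℝ × 𝔼 → ℝ} {M : ℝ}, UniformContinuous q → (∀ p, |q p| ≤ M) →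
      ∀ s τ, Integrable (fun z => q (s, x - √τ • z)) (heatMeasure m) := fun hq hM s τ =>
    (integrable_const _).mono' (hq.continuous.comp (by fun_prop)).aestronglyMeasurable
      (.of_forall fun z => hM _)
  unfold duhamel
  rw [← integral_sub]
  · refine integral_congr_ae (.of_forall fun σ => ?_)
    simp only
    rw [← smul_sub, ← integral_sub (hi hq hM _ _) (hi hr hN _ _)]
  · exact integrableOn_timeAverage (w := fun _ => 1)
      (uniformContinuous_heatAverage_path hq hM).continuous
      (fun p => norm_heatAverage_le (h := fun y => q (p.1, y)) (fun _ => hM _) p.2.1 p.2.2)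
      integrableOn_one_Ioo t t x
  · exact integrableOn_timeAverage (w := fun _ => 1)
      (uniformContinuous_heatAverage_path hr hN).continuous
      (fun p => norm_heatAverage_le (h := fun y => r (p.1, y)) (fun y => hN _) p.2.1 p.2.2)
      integrableOn_one_Ioo t t x

theorem duhamelGradient_sub (hq : UniformContinuous q) (hM : ∀ p, |q p| ≤ M)
    (hr : UniformContinuous r) (hN : ∀ p, |r p| ≤ N) (t : ℝ) (x : 𝔼) :
    duhamelGradient q t x - duhamelGradient r t x
      = duhamelGradient (fun p => q p - r p) t x := by
  have hi : ∀ {q : ℝ × 𝔼 → ℝ} {M : ℝ}, UniformContinuous q → (∀ p, |q p| ≤ M) →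
      ∀ s τ, Integrable (fun z => q (s, x - √τ • z) • z) (heatMeasure m) := fun {q M} hq hM s τ =>
    ((integrable_norm_heatMeasure m).const_mul M).mono'
      ((hq.continuous.comp (by fun_prop)).smul continuous_id).aestronglyMeasurable
      (.of_forall fun z => by
        rw [norm_smul]; exact mul_le_mul_of_nonneg_right (hM _) (norm_nonneg _))
  unfold duhamelGradient
  rw [← integral_sub]
  · refine integral_congr_ae (.of_forall fun σ => ?_)
    simp only
    rw [← smul_sub, ← integral_sub (hi hq hM _ _) (hi hr hN _ _)]
    simp only [sub_smul]
  · exact integrableOn_timeAverage (w := fun σ => (√(1 - σ))⁻¹)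
      (uniformContinuous_heatAverage_smul_path hq hM).continuous
      (norm_heatAverage_smul_path_le hM) integrableOn_inv_sqrt_one_sub _ t x
  · exact integrableOn_timeAverage (w := fun σ => (√(1 - σ))⁻¹)
      (uniformContinuous_heatAverage_smul_path hr hN).continuous
      (norm_heatAverage_smul_path_le hN) integrableOn_inv_sqrt_one_sub _ t x

theorem hasGradientAt_duhamel (hu : UniformContinuous q) (hM : ∀ p, |q p| ≤ M) {t : ℝ}
    (ht : 0 ≤ t) (x : 𝔼) : HasGradientAt (duhamel q t) (duhamelGradient q t x) x := by
  rcases ht.eq_or_lt with rfl | ht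
  · have h1 : duhamel q 0 = fun _ => 0 := by ext; simp [duhamel]
    have h2 : duhamelGradient q 0 x = 0 := by simp [duhamelGradient]
    rw [h1, h2]
    exact hasGradientAt_const x 0
  have hi := integrableOn_timeAverage (w := fun _ => 1)
      (uniformContinuous_heatAverage_path hu hM).continuous
      (fun p => norm_heatAverage_le (h := fun y => q (p.1, y)) (fun _ => hM _) p.2.1 p.2.2)
      integrableOn_one_Ioo t t
  have hb := norm_heatAverage_smul_path_le hM
  have hi' := integrableOn_timeAverage (w := fun σ => (√(1 - σ))⁻¹)
      (uniformContinuous_heatAverage_smul_path hu hM).continuous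
      hb integrableOn_inv_sqrt_one_sub (-(√t / 2)) t
  refine hasGradientAt_integral_of_dominated
    (G := fun y σ => (-(√t / 2) * (√(1 - σ))⁻¹) •
      ∫ z, q (t * σ, y - √(t * (1 - σ)) • z) • z ∂heatMeasure m)
    (bound := fun σ => ‖-(√t / 2) * (√(1 - σ))⁻¹‖ * (M * ∫ z, ‖z‖ ∂heatMeasure m)) univ_mem
    (fun x => (hi x).aestronglyMeasurable) (hi x) (hi' x).aestronglyMeasurable
    (.of_forall fun σ y _ => ?_)
    ((integrableOn_inv_sqrt_one_sub.const_mul _).norm.mul_const _) ?_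
  · rw [norm_smul]
    exact mul_le_mul_of_nonneg_left (hb (t * σ, t * (1 - σ), y)) (norm_nonneg _)
  · filter_upwards [ae_restrict_mem measurableSet_Ioo] with σ hσ y _
    have hσ' : 0 < 1 - σ := by linarith [hσ.2]
    have h1 := hasGradientAt_integral_heatMeasure (mul_pos ht hσ')
      (h := fun y => q (t * σ, y)) (hu.continuous.comp (by fun_prop)) (fun _ => hM _) y
    rw [hasGradientAt_iff_hasFDerivAt] at h1 ⊢
    refine (h1.const_mul (t * 1)).congr_fderiv ?_
    refine ContinuousLinearMap.ext fun v => ?_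
    have e : (-(√t / 2) * (√(1 - σ))⁻¹) = t * -(1 / (2 * √(t * (1 - σ)))) := by
      rw [Real.sqrt_mul ht.le]
      have h2 : 0 < √t := Real.sqrt_pos.2 ht
      have h3 : 0 < √(1 - σ) := Real.sqrt_pos.2 hσ'
      nth_rw 2 [← Real.mul_self_sqrt ht.le]
      field_simp
    rw [e, mul_smul]
    simp
    ring

theorem duhamel_eq_integral_heatSemigroup (q : ℝ × 𝔼 → ℝ) (t : ℝ) (x : 𝔼) :
    duhamel q t x = ∫ s in (0 : ℝ)..t, heatSemigroup m (t - s) (fun y => q (s, y)) x := by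
  have h := intervalIntegral.smul_integral_comp_mul_left (a := 0) (b := 1)
    (fun s => heatSemigroup m (t - s) (fun y => q (s, y)) x) t
  rw [mul_zero, mul_one] at h
  rw [← h, intervalIntegral.integral_of_le zero_le_one, integral_Ioc_eq_integral_Ioo,
    ← integral_smul, duhamel]
  simp only [heatSemigroup_eq_integral_heatMeasure, mul_one, mul_sub]

end Duhamel

section FixedPoint

open scoped BoundedContinuousFunction

/-- The uniformly continuous functions bounded by `R` form a complete set. -/
theorem isComplete_uniformContinuous_norm_le {X Y : Type*} [PseudoMetricSpace X]
    [NormedAddCommGroup Y] [CompleteSpace Y] (R : ℝ) :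
    IsComplete {F : X →ᵇ Y | UniformContinuous F ∧ ∀ x, ‖F x‖ ≤ R} := by
  refine IsClosed.isComplete (IsClosed.inter (isClosed_of_closure_subset fun F hF => ?_) ?_)
  · refine Metric.uniformContinuous_iff.2 fun ε hε => ?_
    obtain ⟨G, hG, hFG⟩ := Metric.mem_closure_iff.1 hF (ε / 3) (by positivity)
    obtain ⟨δ, hδ, h⟩ := Metric.uniformContinuous_iff.1 hG (ε / 3) (by positivity)
    refine ⟨δ, hδ, fun {a b} hab => ?_⟩
    have h1 := BoundedContinuousFunction.dist_coe_le_dist (f := F) (g := G) a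
    have h2 := BoundedContinuousFunction.dist_coe_le_dist (f := F) (g := G) b
    rw [dist_comm] at h2
    have h3 := dist_triangle4 (F a) (G a) (G b) (F b)
    have h4 := h hab
    linarith
  · change IsClosed {F : X →ᵇ Y | ∀ x, ‖F x‖ ≤ R}
    rw [ofPred_forall]
    exact isClosed_iInter fun x => isClosed_le
      (continuous_eval_const x).norm continuous_const

theorem uniformContinuous_clamp (T : ℝ) : UniformContinuous fun t : ℝ => max 0 (min t T) :=
  ((LipschitzWith.id.min_const T).const_max 0).uniformContinuous

/-- Constants governing the contraction: the existence time is `δ ^ 2`. -/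
theorem exists_contraction_time {C K L : ℝ} (hC : 0 ≤ C) (hK : 0 ≤ K) (hL : 0 ≤ L) :
    ∃ δ > 0, δ ^ 2 * K ≤ 1 ∧ δ * (C * K) ≤ 1 ∧ δ ^ 2 * (2 * L) ≤ 1 / 2 ∧
      δ * (C * (2 * L)) ≤ 1 / 2 := by
  have hD : 0 < 1 + (1 + C) * (K + 4 * L) := by positivity
  have hbound : ∀ y, y ≤ 1 + (1 + C) * (K + 4 * L) →
      1 / (1 + (1 + C) * (K + 4 * L)) * y ≤ 1 := fun y hy => by
    rw [one_div, inv_mul_eq_div]; exact (div_le_one hD).2 hy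
  set δ := 1 / (1 + (1 + C) * (K + 4 * L)) with hδ
  have hδ0 : 0 < δ := by positivity
  have hCK := mul_nonneg hC hK
  have hCL := mul_nonneg hC hL
  have hδ1 : δ ≤ 1 := by simpa using hbound 1 (by nlinarith)
  have hsq : δ ^ 2 ≤ δ := by nlinarith
  have h1 := hbound K (by nlinarith)
  have h2 := hbound (C * K) (by nlinarith)
  have h3 := hbound (4 * L) (by nlinarith)
  have h4 := hbound (C * (4 * L)) (by nlinarith)
  refine ⟨δ, hδ0, ?_, h2, ?_, ?_⟩
  · exact (mul_le_mul_of_nonneg_right hsq hK).trans h1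
  · exact (mul_le_mul_of_nonneg_right hsq (by positivity)).trans (by linarith)
  · linarith

variable {m : ℕ}

local notation "𝔼" => EuclideanSpace ℝ (Fin m)

/-- Existence of a fixed point `(u, g)` of the Duhamel map, with `g` in the role of `∇u`. -/
theorem exists_duhamel_fixedPoint {f : 𝔼 → ℝ} {g : 𝔼 → 𝔼} {M : ℝ}
    (hf : UniformContinuous f) (hg : UniformContinuous g) (hfM : ∀ x, |f x| ≤ M)
    (hgM : ∀ x, ‖g x‖ ≤ M) {Q : ℝ → 𝔼 → ℝ}
    (hQ : ∀ r > (0:ℝ), ∃ L : ℝ, ∀ a b : ℝ, ∀ p q : 𝔼, |a| ≤ r → |b| ≤ r → ‖p‖ ≤ r → ‖q‖ ≤ r →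
      |Q a p - Q b q| ≤ L * (|a - b| + ‖p - q‖)) :
    ∃ T > (0:ℝ), ∃ F : ℝ × 𝔼 →ᵇ ℝ × 𝔼, UniformContinuous F ∧
      UniformContinuous (fun p => Q (F p).1 (F p).2) ∧ (∃ K, ∀ p, |Q (F p).1 (F p).2| ≤ K) ∧
      ∀ t ∈ Icc 0 T, ∀ x, F (t, x) =
        (∫ z, f (x - √t • z) ∂heatMeasure m + duhamel (fun p => Q (F p).1 (F p).2) t x,
          ∫ z, g (x - √t • z) ∂heatMeasure m +
            duhamelGradient (fun p => Q (F p).1 (F p).2) t x) := by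
  have hM0 : 0 ≤ M := (abs_nonneg _).trans (hfM 0)
  obtain ⟨L₀, hL₀⟩ := hQ (M + 1) (by positivity)
  obtain ⟨L, hL0, hL⟩ : ∃ L ≥ 0, ∀ v w : ℝ × 𝔼, ‖v‖ ≤ M + 1 → ‖w‖ ≤ M + 1 →
      |Q v.1 v.2 - Q w.1 w.2| ≤ 2 * L * ‖v - w‖ := by
    refine ⟨max L₀ 0, le_max_right _ _, fun v w hv hw => ?_⟩
    refine (hL₀ _ _ _ _ ((norm_fst_le v).trans hv) ((norm_fst_le w).trans hw)
      ((norm_snd_le v).trans hv) ((norm_snd_le w).trans hw)).trans ?_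
    have h1 : |v.1 - w.1| ≤ ‖v - w‖ := norm_fst_le (v - w)
    have h2 : ‖v.2 - w.2‖ ≤ ‖v - w‖ := norm_snd_le (v - w)
    calc L₀ * (|v.1 - w.1| + ‖v.2 - w.2‖) ≤ max L₀ 0 * (‖v - w‖ + ‖v - w‖) := by
          gcongr
          exact le_max_left _ _
      _ = _ := by ring
  obtain ⟨K, hK0, hK⟩ : ∃ K ≥ 0, ∀ v : ℝ × 𝔼, ‖v‖ ≤ M + 1 → |Q v.1 v.2| ≤ K := by
    refine ⟨|Q 0 0| + 2 * L * (M + 1), by positivity, fun v hv => ?_⟩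
    have h1 := hL v 0 hv (by simpa using by positivity)
    rw [sub_zero] at h1
    have h2 := abs_sub_abs_le_abs_sub (Q v.1 v.2) (Q 0 0)
    have h3 : 2 * L * ‖v‖ ≤ 2 * L * (M + 1) := by gcongr
    have h4 : |Q v.1 v.2 - Q 0 0| ≤ 2 * L * ‖v‖ := h1
    linarith
  obtain ⟨δ, hδ, hδ1, hδ2, hδ3, hδ4⟩ := exists_contraction_time (duhamelConst_nonneg m) hK0 hL0
  set c : ℝ → ℝ := fun t => max 0 (min t (δ ^ 2)) with hc
  have hcu : UniformContinuous c := uniformContinuous_clamp _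
  have hc0 : ∀ t, 0 ≤ c t := fun t => le_max_left _ _
  have hcT : ∀ t, c t ≤ δ ^ 2 := fun t => max_le (by positivity) (min_le_right _ _)
  have hcs : ∀ t, √(c t) ≤ δ := fun t => (Real.sqrt_le_left hδ.le).2 (hcT t)
  have hcC : ∀ t, |c t| ≤ δ ^ 2 := fun t => by rw [abs_of_nonneg (hc0 t)]; exact hcT t
  set A : Set (ℝ × 𝔼 →ᵇ ℝ × 𝔼) := {F | UniformContinuous F ∧ ∀ p, ‖F p‖ ≤ M + 1} with hA
  have hqM : ∀ F ∈ A, ∀ p, |Q (F p).1 (F p).2| ≤ K := fun F hF p => hK _ (hF.2 p)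
  have hqu : ∀ F ∈ A, UniformContinuous fun p => Q (F p).1 (F p).2 := fun F hF => by
    have h := (tendsto_uniformity_iff_dist_tendsto_zero.1 hF.1).const_mul (2 * L)
    rw [mul_zero] at h
    refine tendsto_uniformity_iff_dist_tendsto_zero.2
      (squeeze_zero (fun _ => dist_nonneg) (fun p => ?_) h)
    rw [dist_eq_norm]
    exact hL _ _ (hF.2 _) (hF.2 _)
  have hstep : ∀ F ∈ A, ∃ G ∈ A, ∀ p, G p =
      (∫ z, f (p.2 - √(c p.1) • z) ∂heatMeasure m +
          duhamel (fun p => Q (F p).1 (F p).2) (c p.1) p.2,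
        ∫ z, g (p.2 - √(c p.1) • z) ∂heatMeasure m +
          duhamelGradient (fun p => Q (F p).1 (F p).2) (c p.1) p.2) := by
    intro F hF
    have hcp : UniformContinuous fun p : ℝ × 𝔼 => (c p.1, p.2) :=
      (hcu.comp uniformContinuous_fst).prodMk uniformContinuous_snd
    have hu := (((uniformContinuous_heatAverage hf hfM).comp hcp).add
      (uniformContinuous_duhamel (hqu F hF) (hqM F hF) hcu hcC)).prodMk
      (((uniformContinuous_heatAverage hg hgM).comp hcp).add
      (uniformContinuous_duhamelGradient (hqu F hF) (hqM F hF) hcu hcC))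
    refine ⟨BoundedContinuousFunction.ofNormedAddCommGroup _ hu.continuous (M + 1) fun p => ?_,
      ⟨hu, fun p => ?_⟩, fun p => rfl⟩
    all_goals
      refine norm_prod_le_iff.2 ⟨(norm_add_le _ _).trans (add_le_add
        (norm_heatAverage_le hfM _ _) ((abs_duhamel_le (hqM F hF) (hc0 _) _).trans ?_)),
        (norm_add_le _ _).trans (add_le_add
        (norm_heatAverage_le hgM _ _) ((norm_duhamelGradient_le (hqM F hF) _ _).trans ?_))⟩
      · exact (mul_le_mul_of_nonneg_right (hcT _) hK0).trans hδ1
      · exact (mul_le_mul_of_nonneg_right (hcs _)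
          (mul_nonneg (duhamelConst_nonneg m) hK0)).trans hδ2
  choose! Φ hΦA hΦ using hstep
  have hlip : LipschitzWith (1 / 2) (MapsTo.restrict Φ A A hΦA) := by
    refine LipschitzWith.of_dist_le_mul fun ⟨F, hF⟩ ⟨G, hG⟩ => ?_
    change dist (Φ F) (Φ G) ≤ ((1 / 2 : NNReal) : ℝ) * dist F G
    have hd : ∀ p, |Q (F p).1 (F p).2 - Q (G p).1 (G p).2| ≤ 2 * L * dist F G := fun p => by
      refine (hL _ _ (hF.2 p) (hG.2 p)).trans ?_
      rw [← dist_eq_norm]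
      gcongr
      exact BoundedContinuousFunction.dist_coe_le_dist p
    refine (BoundedContinuousFunction.dist_le (by positivity)).2 fun p => ?_
    rw [hΦ F hF, hΦ G hG, Prod.dist_eq, dist_add_left, dist_add_left, Real.dist_eq, dist_eq_norm,
      duhamel_sub (hqu F hF) (hqM F hF) (hqu G hG) (hqM G hG),
      duhamelGradient_sub (hqu F hF) (hqM F hF) (hqu G hG) (hqM G hG)]
    have h0 := duhamelConst_nonneg m
    refine max_le ((abs_duhamel_le hd (hc0 _) _).trans ?_)
      ((norm_duhamelGradient_le hd _ _).trans ?_)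
    · calc c p.1 * (2 * L * dist F G) ≤ δ ^ 2 * (2 * L * dist F G) := by
            gcongr; exact hcT _
        _ = δ ^ 2 * (2 * L) * dist F G := by ring
        _ ≤ _ := by push_cast; gcongr
    · calc √(c p.1) * (duhamelConst m * (2 * L * dist F G))
          ≤ δ * (duhamelConst m * (2 * L * dist F G)) := by gcongr; exact hcs _
        _ = δ * (duhamelConst m * (2 * L)) * dist F G := by ring
        _ ≤ _ := by push_cast; gcongr
  have h0A : (0 : ℝ × 𝔼 →ᵇ ℝ × 𝔼) ∈ A :=
    ⟨uniformContinuous_const, fun p => by simpa using by positivity⟩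
  obtain ⟨F, hFA, hfix, -⟩ := ContractingWith.exists_fixedPoint'
    (isComplete_uniformContinuous_norm_le (M + 1)) hΦA
    ⟨by rw [← NNReal.coe_lt_coe]; norm_num, hlip⟩ h0A (edist_ne_top _ _)
  refine ⟨δ ^ 2, by positivity, F, hFA.1, hqu F hFA, ⟨K, hqM F hFA⟩, fun t ht x => ?_⟩
  have hct : c t = t := by
    rw [hc]; simp only; rw [min_eq_left ht.2, max_eq_right ht.1]
  have h := hΦ F hFA (t, x)
  rw [hfix.eq] at h
  rw [h]
  simp only [hct]

end FixedPoint

/-- **Short-time existence of a mild solution of `∂_t u − Δu = Q(u, ∇u)` (Euclidean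
model).** For `f ∈ C¹` with `f, ∇f` bounded and uniformly continuous, and
`Q : ℝ × ℝ^m → ℝ` Lipschitz on bounded sets, there exist `T > 0` and a function
`u : [0,T] × ℝ^m → ℝ` with `u(0,·) = f`, each `u(t,·)` of class `C¹` bounded in
`C¹`-norm uniformly in `t`, `t ↦ u(t,·)` continuous in `C¹` sup-norm, and
`u(t,x) = (P_t f)(x) + ∫₀^t P_{t−s}( y ↦ Q(u(s,y), ∇u(s,y)) )(x) ds`. -/
theorem semilinear_heat_gradient_short_time_existence (m : ℕ) (hm : 1 ≤ m)
    (f : EuclideanSpace ℝ (Fin m) → ℝ)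
    (hf : ContDiff ℝ 1 f)
    (hfb : ∃ M : ℝ, ∀ x, |f x| + ‖gradient f x‖ ≤ M)
    (hfc : UniformContinuous f) (hgc : UniformContinuous (gradient f))
    (Q : ℝ → EuclideanSpace ℝ (Fin m) → ℝ)
    (hQ : ∀ r > (0:ℝ), ∃ L : ℝ, ∀ a b : ℝ, ∀ p q : EuclideanSpace ℝ (Fin m),
      |a| ≤ r → |b| ≤ r → ‖p‖ ≤ r → ‖q‖ ≤ r →
      |Q a p - Q b q| ≤ L * (|a - b| + ‖p - q‖)) :
    ∃ T > (0:ℝ), ∃ u : ℝ → EuclideanSpace ℝ (Fin m) → ℝ,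
      u 0 = f ∧
      (∀ t ∈ Icc (0:ℝ) T, ContDiff ℝ 1 (u t)) ∧
      (∃ M : ℝ, ∀ t ∈ Icc (0:ℝ) T, ∀ x, |u t x| + ‖gradient (u t) x‖ ≤ M) ∧
      (∀ t₀ ∈ Icc (0:ℝ) T, ∀ ε > (0:ℝ), ∃ δ > (0:ℝ), ∀ t ∈ Icc (0:ℝ) T,
        |t - t₀| < δ → ∀ x,
          |u t x - u t₀ x| + ‖gradient (u t) x - gradient (u t₀) x‖ ≤ ε) ∧
      (∀ t ∈ Icc (0:ℝ) T, ∀ x,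
        u t x = heatSemigroup m t f x +
          ∫ s in (0:ℝ)..t,
            heatSemigroup m (t - s) (fun y => Q (u s y) (gradient (u s) y)) x) := by
  obtain ⟨M, hM⟩ := hfb
  have hfM : ∀ x, |f x| ≤ M := fun x => by linarith [hM x, norm_nonneg (gradient f x)]
  have hgM : ∀ x, ‖gradient f x‖ ≤ M := fun x => by linarith [hM x, abs_nonneg (f x)]
  obtain ⟨T, hT, F, hFu, hqu, ⟨K, hqK⟩, hF⟩ := exists_duhamel_fixedPoint hfc hgc hfM hgM hQ
  have hgrad : ∀ t ∈ Icc 0 T, ∀ x, HasGradientAt (fun x => (F (t, x)).1) (F (t, x)).2 x := by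
    intro t ht x
    have e : (fun x => (F (t, x)).1) = fun x => ∫ z, f (x - √t • z) ∂heatMeasure m +
        duhamel (fun p => Q (F p).1 (F p).2) t x := by
      ext y; rw [hF t ht y]
    rw [e, hF t ht x]
    have h1 := hasGradientAt_heatAverage hf hfM hgM hgc.continuous t x
    have h2 := hasGradientAt_duhamel hqu hqK ht.1 x
    rw [hasGradientAt_iff_hasFDerivAt] at h1 h2 ⊢
    exact (h1.add h2).congr_fderiv (map_add _ _ _).symm
  have hgrad' : ∀ t ∈ Icc 0 T, ∀ x, gradient (fun x => (F (t, x)).1) x = (F (t, x)).2 :=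
    fun t ht x => (hgrad t ht x).gradient
  refine ⟨T, hT, fun t x => (F (t, x)).1, ?_, fun t ht => ?_, ⟨‖F‖ + ‖F‖, fun t ht x => ?_⟩,
    fun t₀ ht₀ ε hε => ?_, fun t ht x => ?_⟩
  · ext x
    beta_reduce
    rw [hF 0 ⟨le_rfl, hT.le⟩ x]
    simp [duhamel]
  · refine contDiff_one_iff_hasFDerivAt.2 ⟨fun x => InnerProductSpace.toDual ℝ _ (F (t, x)).2, ?_,
      fun x => (hgrad t ht x).hasFDerivAt⟩
    have := F.continuous
    exact (InnerProductSpace.toDual ℝ _).continuous.comp (by fun_prop)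
  · rw [hgrad' t ht x]
    exact add_le_add ((norm_fst_le _).trans (F.norm_coe_le_norm _))
      ((norm_snd_le _).trans (F.norm_coe_le_norm _))
  · obtain ⟨δ, hδ, h⟩ := Metric.uniformContinuous_iff.1 hFu (ε / 2) (by positivity)
    refine ⟨δ, hδ, fun t ht htt x => ?_⟩
    rw [hgrad' t ht x, hgrad' t₀ ht₀ x]
    have h1 := h (a := (t, x)) (b := (t₀, x)) (by simpa [Prod.dist_eq, Real.dist_eq, hδ] using htt)
    rw [dist_eq_norm] at h1
    have h2 : |(F (t, x)).1 - (F (t₀, x)).1| ≤ _ := norm_fst_le (F (t, x) - F (t₀, x))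
    have h3 : ‖(F (t, x)).2 - (F (t₀, x)).2‖ ≤ _ := norm_snd_le (F (t, x) - F (t₀, x))
    linarith
  · beta_reduce
    rw [hF t ht x, heatSemigroup_eq_integral_heatMeasure, duhamel_eq_integral_heatSemigroup]
    refine congrArg (_ + ·) ?_
    refine intervalIntegral.integral_congr fun s hs => ?_
    rw [uIcc_of_le ht.1] at hs
    simp only [hgrad' s ⟨hs.1, hs.2.trans ht.2⟩]
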